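/- Let Σ be a finite alphabet and let u, v be nonempty words over Σ forming a minimal pair, i.e., there do not exist words a, b with |a|+|b| < |u|+|v| and u, v ∈ {a,b}^*. Let σ : {x,y}^* → Σ^* be the monoid morphism with σ(x) = u and σ(y) = v. Let w ∈ {x,y}^* be a word containing at least five occurrences of the factor xy, and let z be a word over Σ with |z| = max(|u|,|v|) such that z does not have u as a prefix and does not have v as a prefix. Then σ(w)·z is not a factor of any word in {u,v}^*; equivalently, there is no word w' ∈ {x,y}^* such that σ(w)·z is a factor of σ(w'). -/

import Mathlib

/-- The factor of the infinite word `x` of length `n` starting at position `i`. -/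
def factorAt {A : Type*} (x : ℕ → A) (i n : ℕ) : List A :=
  (List.range n).map fun j => x (i + j)

/-- `w` is a factor of the infinite word `x`. -/
def IsFactor {A : Type*} (x : ℕ → A) (w : List A) : Prop :=
  ∃ i : ℕ, w = factorAt x i w.length

/-- The `n`-th power of the finite word `w`. -/
def wpow {A : Type*} (w : List A) (n : ℕ) : List A :=
  (List.replicate n w).flatten

/-- A nonempty finite word is primitive if it is not a proper power. -/
def Primitive {A : Type*} (w : List A) : Prop :=
  w ≠ [] ∧ ∀ (t : List A) (e : ℕ), 2 ≤ e → w ≠ wpow t e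

/-- `w` occurs with unbounded exponent in the infinite word `x`. -/
def UnboundedExponent {A : Type*} (x : ℕ → A) (w : List A) : Prop :=
  ∀ n : ℕ, 1 ≤ n → IsFactor x (wpow w n)

/-- `w` belongs to `{a,b}^*`, the submonoid generated by `a` and `b`. -/
def InStarPair {A : Type*} (a b w : List A) : Prop :=
  ∃ l : List (List A), (∀ t ∈ l, t = a ∨ t = b) ∧ w = l.flatten

/-- `(u, v)` is a minimal pair: there is no pair `(a, b)` of smaller total length
with `u, v ∈ {a,b}^*`. -/
def MinimalPair {A : Type*} (u v : List A) : Prop :=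
  ¬ ∃ a b : List A, a.length + b.length < u.length + v.length ∧
      InStarPair a b u ∧ InStarPair a b v

/-- The finite word `w` is a prefix of the infinite word `x`. -/
def WordPrefix {A : Type*} (x : ℕ → A) (w : List A) : Prop :=
  w = factorAt x 0 w.length

/-- The infinite word `x` belongs to `{u,v}^ω`, i.e. `x` is an infinite
concatenation of blocks, each equal to `u` or to `v`. -/
def InOmegaPair {A : Type*} (x : ℕ → A) (u v : List A) : Prop :=
  ∃ f : ℕ → List A, (∀ n, f n = u ∨ f n = v) ∧
    ∀ n : ℕ, WordPrefix x (((List.range n).map f).flatten)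

/-- The morphism `{x,y}^* → Σ^*` sending `x` (encoded `false`) to `u` and
`y` (encoded `true`) to `v`. -/
def sigmaMap {A : Type*} (u v : List A) (w : List Bool) : List A :=
  (w.map fun c => if c then v else u).flatten

/-- The number of occurrences of the factor `xy` (encoded `[false, true]`) in `w`. -/
def countXY (w : List Bool) : ℕ :=
  ((List.range w.length).filter fun i => decide ([false, true] <+: w.drop i)).length

section Generation

variable {A : Type*}

/-- `w` is a concatenation of words of `X`. -/
def Gen (X : Set (List A)) (w : List A) : Prop :=
  ∃ l : List (List A), (∀ t ∈ l, t ∈ X) ∧ w = l.flatten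

/-- Every word has at most one factorization over `X`. -/
def IsCode (X : Set (List A)) : Prop :=
  ∀ l₁ l₂ : List (List A), (∀ t ∈ l₁, t ∈ X) → (∀ t ∈ l₂, t ∈ X) →
    l₁.flatten = l₂.flatten → l₁ = l₂

theorem Gen.nil (X : Set (List A)) : Gen X [] := ⟨[], by simp, by simp⟩

theorem Gen.of_mem {X : Set (List A)} {x : List A} (hx : x ∈ X) : Gen X x :=
  ⟨[x], by simpa using hx, by simp⟩

theorem Gen.append {X : Set (List A)} {x y : List A} (hx : Gen X x) (hy : Gen X y) :
    Gen X (x ++ y) := by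
  obtain ⟨l, hl, rfl⟩ := hx
  obtain ⟨m, hm, rfl⟩ := hy
  refine ⟨l ++ m, ?_, by simp⟩
  intro t ht
  rcases List.mem_append.1 ht with h | h
  · exact hl t h
  · exact hm t h

theorem wpow_zero (w : List A) : wpow w 0 = [] := by simp [wpow]

theorem wpow_succ (w : List A) (n : ℕ) : wpow w (n + 1) = w ++ wpow w n := by
  simp [wpow, List.replicate_succ]

theorem wpow_succ' (w : List A) (n : ℕ) : wpow w (n + 1) = wpow w n ++ w := by
  simp [wpow, List.replicate_succ']

theorem Gen.wpow {X : Set (List A)} {x : List A} (hx : Gen X x) (n : ℕ) :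
    Gen X (wpow x n) := by
  induction n with
  | zero => rw [wpow_zero]; exact Gen.nil X
  | succ n ih => rw [wpow_succ]; exact hx.append ih

theorem Gen.trans {X Y : Set (List A)} (h : ∀ x ∈ X, Gen Y x) {w : List A} (hw : Gen X w) :
    Gen Y w := by
  obtain ⟨l, hl, rfl⟩ := hw
  induction l with
  | nil => exact Gen.nil Y
  | cons a l ih =>
    rw [List.flatten_cons]
    exact (h a (hl a (by simp))).append (ih fun t ht => hl t (by simp [ht]))

theorem IsCode.head_eq {X : Set (List A)} (hX : IsCode X) {b c r s : List A} (hb : b ∈ X)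
    (hc : c ∈ X) (hr : Gen X r) (hs : Gen X s) (h : b ++ r = c ++ s) : b = c := by
  obtain ⟨l, hl, rfl⟩ := hr
  obtain ⟨m, hm, rfl⟩ := hs
  have := hX (b :: l) (c :: m) (by simpa using ⟨hb, hl⟩) (by simpa using ⟨hc, hm⟩)
    (by simpa using h)
  exact (List.cons.inj this).1

/-- A set of nonempty words which is not a code satisfies a relation between words
with distinct first factors. -/
theorem exists_relation_of_not_isCode {X : Set (List A)} (h0 : [] ∉ X) (hX : ¬ IsCode X) :
    ∃ x ∈ X, ∃ y ∈ X, x ≠ y ∧ ∃ a b, Gen X a ∧ Gen X b ∧ x ++ a = y ++ b := by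
  by_contra! hcon
  apply hX
  intro l₁
  induction l₁ with
  | nil =>
    intro l₂ _ h₂ h
    cases l₂ with
    | nil => rfl
    | cons b l =>
      have : b = [] := by simp at h; exact h.1
      exact absurd (this ▸ h₂ b (by simp)) h0
  | cons a l ih =>
    intro l₂ h₁ h₂ h
    cases l₂ with
    | nil =>
      have : a = [] := by simp at h; exact h.1
      exact absurd (this ▸ h₁ a (by simp)) h0
    | cons b m =>
      have hl : ∀ t ∈ l, t ∈ X := fun t ht => h₁ t (by simp [ht])
      have hm : ∀ t ∈ m, t ∈ X := fun t ht => h₂ t (by simp [ht])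
      rw [List.flatten_cons, List.flatten_cons] at h
      by_cases hab : a = b
      · subst hab
        rw [ih m hl hm (List.append_cancel_left h)]
      · exact absurd h (hcon a (h₁ a (by simp)) b (h₂ b (by simp)) hab _ _ ⟨l, hl, rfl⟩
          ⟨m, hm, rfl⟩)

/-- Free hull of a finite set of nonempty words: all the words factor over a code, every
element of which is the first factor of one of the words. -/
theorem exists_hull (n : ℕ) : ∀ X : Finset (List A), [] ∉ X → ∑ x ∈ X, x.length ≤ n →
    ∃ (B : Set (List A)) (h : List A → List A), IsCode B ∧
      (∀ x ∈ X, h x ∈ B ∧ ∃ y, Gen B y ∧ x = h x ++ y) ∧ ∀ b ∈ B, ∃ x ∈ X, h x = b := by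
  classical
  induction n with
  | zero =>
    intro X h0 hs
    refine ⟨∅, id, ?_, ?_, by simp⟩
    · intro l m hl hm _
      rw [List.eq_nil_iff_forall_not_mem.2 hl, List.eq_nil_iff_forall_not_mem.2 hm]
    · intro x hx
      have : x.length ≤ 0 := (Finset.single_le_sum (f := fun x : List A => x.length)
        (fun _ _ => Nat.zero_le _) hx).trans hs
      exact absurd (List.length_eq_zero_iff.1 (Nat.le_zero.1 this) ▸ hx) h0
  | succ n ih =>
    intro X h0 hs
    by_cases hX : IsCode (X : Set (List A))
    · exact ⟨X, id, hX, fun x hx => ⟨hx, [], Gen.nil _, by simp⟩, fun b hb => ⟨b, hb, rfl⟩⟩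
    obtain ⟨x, hx, y, hy, hxy, a, b, ha, hb, hab, hle⟩ : ∃ x ∈ (X : Set (List A)),
        ∃ y ∈ (X : Set (List A)), x ≠ y ∧ ∃ a b, Gen (X : Set (List A)) a ∧
        Gen (X : Set (List A)) b ∧ x ++ a = y ++ b ∧ x.length ≤ y.length := by
      obtain ⟨x, hx, y, hy, hxy, a, b, ha, hb, hab⟩ :=
        exists_relation_of_not_isCode (by simpa using h0) hX
      rcases le_total x.length y.length with h | h
      · exact ⟨x, hx, y, hy, hxy, a, b, ha, hb, hab, h⟩
      · exact ⟨y, hy, x, hx, hxy.symm, b, a, hb, ha, hab.symm, h⟩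
    obtain ⟨y', rfl⟩ : x <+: y :=
      List.prefix_of_prefix_length_le ⟨a, rfl⟩ ⟨b, hab.symm⟩ hle
    have hy' : y' ≠ [] := by rintro rfl; simp at hxy
    rw [List.append_assoc] at hab
    have hab := List.append_cancel_left hab
    rw [Finset.mem_coe] at hx hy
    have hx0 : 0 < x.length := List.length_pos_iff.2 fun h => h0 (h ▸ hx)
    have hlt : ∑ z ∈ insert y' (X.erase (x ++ y')), z.length ≤ n := by
      have h1 := Finset.add_sum_erase X (fun z : List A => z.length) hy
      have h2 : ∑ z ∈ insert y' (X.erase (x ++ y')), z.length ≤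
          y'.length + ∑ z ∈ X.erase (x ++ y'), z.length := by
        by_cases hm : y' ∈ X.erase (x ++ y')
        · rw [Finset.insert_eq_of_mem hm]; omega
        · rw [Finset.sum_insert hm]
      simp only [List.length_append] at h1
      omega
    have h0' : [] ∉ insert y' (X.erase (x ++ y')) := by
      simp only [Finset.mem_insert, Finset.mem_erase, not_or, not_and]
      exact ⟨fun h => hy' h.symm, fun _ => h0⟩
    obtain ⟨B, h, hB, hf, hc⟩ := ih _ h0' hlt
    have hxX : x ∈ insert y' (X.erase (x ++ y')) := by simp [hx, hy']
    have hyX : y' ∈ insert y' (X.erase (x ++ y')) := by simp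
    have hmem : ∀ z ∈ X, z ≠ x ++ y' → z ∈ insert y' (X.erase (x ++ y')) := by
      intro z hz hne; simp [hz, hne]
    have gB : ∀ z ∈ insert y' (X.erase (x ++ y')), Gen B z := by
      intro z hz
      obtain ⟨hz1, r, hr, hzr⟩ := hf z hz
      rw [hzr]; exact (Gen.of_mem hz1).append hr
    have gX : ∀ z ∈ (X : Set (List A)), Gen B z := by
      intro z hz
      by_cases hne : z = x ++ y'
      · rw [hne]; exact (gB x hxX).append (gB y' hyX)
      · exact gB z (hmem z hz hne)
    refine ⟨B, fun z => if z = x ++ y' then h x else h z, hB, ?_, ?_⟩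
    · intro z hz
      by_cases hne : z = x ++ y'
      · obtain ⟨hz1, r, hr, hzr⟩ := hf x hxX
        simp only [hne, if_true]
        refine ⟨hz1, r ++ y', hr.append (gB y' hyX), ?_⟩
        rw [← List.append_assoc, ← hzr]
      · simp only [hne, if_false]
        exact hf z (hmem z hz hne)
    · have key : ∃ z ∈ X, z ≠ x ++ y' ∧ h z = h y' := by
        obtain ⟨hy1, r, hr, hyr⟩ := hf y' hyX
        obtain ⟨l, hl, rfl⟩ := ha
        have main : ∀ z ∈ insert y' (X.erase (x ++ y')), ∀ s, Gen B s →
            z ++ s = y' ++ b → h z = h y' := by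
          intro z hz s hs hzs
          obtain ⟨hz1, q, hq, hzq⟩ := hf z hz
          refine hB.head_eq hz1 hy1 (hq.append hs) (hr.append (hb.trans gX)) ?_
          rw [← List.append_assoc, ← List.append_assoc, ← hzq, ← hyr, hzs]
        cases l with
        | nil => exact absurd hab (by simp [hy'])
        | cons c l =>
          rw [List.flatten_cons] at hab
          have hl' : Gen B l.flatten :=
            Gen.trans gX ⟨l, fun t ht => hl t (by simp [ht]), rfl⟩
          by_cases hne : c = x ++ y'
          · rw [hne, List.append_assoc] at hab
            exact ⟨x, hx, hxy, main x hxX _ ((gB y' hyX).append hl') hab⟩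
          · have hcX : c ∈ X := hl c (by simp)
            exact ⟨c, hcX, hne, main c (hmem c hcX hne) _ hl' hab⟩
      intro d hd
      obtain ⟨z, hz, rfl⟩ := hc d hd
      rw [Finset.mem_insert, Finset.mem_erase] at hz
      rcases hz with rfl | ⟨hne, hz⟩
      · obtain ⟨z', hz', hne, he⟩ := key
        exact ⟨z', hz', by simp [hne, he]⟩
      · exact ⟨z, hz, by simp [hne]⟩

/-- If a minimal pair is generated by `X` and the relations satisfied by `X` force every
first factor in the free hull to agree with that of `c` or that of `d`, then `c` and `d`
cannot be short. -/
theorem MinimalPair.false_of_relations {S L : List A} (hm : MinimalPair S L)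
    (X : Finset (List A)) (h0 : [] ∉ X) {c d : List A} (hc : c ∈ X) (hd : d ∈ X)
    (hcd : c.length + d.length < S.length + L.length)
    (hS : Gen (X : Set (List A)) S) (hL : Gen (X : Set (List A)) L)
    (H : ∀ h : List A → List A, (∀ x ∈ X, ∀ y ∈ X, ∀ a b, Gen (X : Set (List A)) a →
      Gen (X : Set (List A)) b → x ++ a = y ++ b → h x = h y) →
      ∀ x ∈ X, h x = h c ∨ h x = h d) : False := by
  obtain ⟨B, h, hB, hf, hcov⟩ := exists_hull _ X h0 le_rfl
  have gB : ∀ z ∈ (X : Set (List A)), Gen B z := by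
    intro z hz
    obtain ⟨hz1, r, hr, hzr⟩ := hf z hz
    rw [hzr]; exact (Gen.of_mem hz1).append hr
  have hlen : ∀ z ∈ X, (h z).length ≤ z.length := by
    intro z hz
    obtain ⟨-, r, -, hzr⟩ := hf z hz
    have := congrArg List.length hzr
    rw [List.length_append] at this
    omega
  have H' := H h (by
    intro x hx y hy a b ha hb hab
    obtain ⟨hx1, r, hr, hxr⟩ := hf x hx
    obtain ⟨hy1, s, hs, hys⟩ := hf y hy
    refine hB.head_eq hx1 hy1 (hr.append (ha.trans gB)) (hs.append (hb.trans gB)) ?_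
    rw [← List.append_assoc, ← List.append_assoc, ← hxr, ← hys, hab])
  have hB2 : ∀ b ∈ B, b = h c ∨ b = h d := by
    intro b hb
    obtain ⟨x, hx, rfl⟩ := hcov b hb
    exact H' x hx
  have star : ∀ w, Gen (X : Set (List A)) w → InStarPair (h c) (h d) w := by
    intro w hw
    obtain ⟨l, hl, hw⟩ := hw.trans gB
    exact ⟨l, fun t ht => hB2 t (hl t ht), hw⟩
  have h1 := hlen c hc
  have h2 := hlen d hd
  exact hm ⟨h c, h d, by omega, star S hS, star L hL⟩

/-- A minimal pair is not generated by three words satisfying a nontrivial relation. -/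
theorem MinimalPair.false_of_relation {S L : List A} (hm : MinimalPair S L) (x y z : List A)
    (hx : x ≠ []) (hy : y ≠ []) (hz : z ≠ [])
    (hxz : x.length + z.length < S.length + L.length)
    (hS : Gen {x, y, z} S) (hL : Gen {x, y, z} L) (a b : List A)
    (ha : Gen {x, y, z} a) (hb : Gen {x, y, z} b) (h : x ++ a = y ++ b) : False := by
  classical
  refine hm.false_of_relations {x, y, z} (by simp [hx.symm, hy.symm, hz.symm]) (c := x)
    (d := z) (by simp) (by simp) hxz (by simpa using hS) (by simpa using hL) ?_
  intro f hf w hw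
  simp only [Finset.mem_insert, Finset.mem_singleton] at hw
  have := hf x (by simp) y (by simp) a b (by simpa using ha) (by simpa using hb) h
  rcases hw with rfl | rfl | rfl <;> simp [this]

end Generation

section Equations

variable {A : Type*} {S L : List A}

theorem MinimalPair.symm (hm : MinimalPair S L) : MinimalPair L S := by
  rintro ⟨a, b, h, h1, h2⟩
  exact hm ⟨a, b, by omega, h2, h1⟩

theorem MinimalPair.false_of_pair (hm : MinimalPair S L) (a b : List A)
    (h : a.length + b.length < S.length + L.length) (hS : Gen {a, b} S) (hL : Gen {a, b} L) :
    False :=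
  hm ⟨a, b, h, by simpa [Gen, InStarPair] using hS, by simpa [Gen, InStarPair] using hL⟩

theorem MinimalPair.not_prefix_long (hm : MinimalPair S L) (hS : S ≠ []) : ¬ S <+: L := by
  rintro ⟨t, rfl⟩
  have := List.length_pos_iff.2 hS
  refine hm.false_of_pair S t (by simp; omega) (Gen.of_mem (by simp)) ?_
  exact (Gen.of_mem (by simp)).append (Gen.of_mem (by simp))

theorem MinimalPair.not_suffix (hm : MinimalPair S L) (hS : S ≠ []) : ¬ S <:+ L := by
  rintro ⟨t, rfl⟩
  have := List.length_pos_iff.2 hS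
  refine hm.false_of_pair S t (by simp; omega) (Gen.of_mem (by simp)) ?_
  exact (Gen.of_mem (by simp)).append (Gen.of_mem (by simp))

theorem MinimalPair.false_of_comm (hm : MinimalPair S L) (hL : L ≠ []) {a b : List A}
    (ha : a ≠ []) (hb : b ≠ []) (h1 : S = a ++ b) (h2 : S = b ++ a) : False := by
  have := List.length_pos_iff.2 hb
  have hl := congrArg List.length h1
  rw [List.length_append] at hl
  refine hm.false_of_relation a b L ha hb hL (by omega) ?_ (Gen.of_mem (by simp)) b a
    (Gen.of_mem (by simp)) (Gen.of_mem (by simp)) (h1 ▸ h2)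
  rw [h1]
  exact (Gen.of_mem (by simp)).append (Gen.of_mem (by simp))

theorem MinimalPair.false_of_swap (hm : MinimalPair S L) (hS : S ≠ [])
    {s t : List A} (hs : s ≠ []) (ht : t ≠ []) (m : ℕ)
    (h1 : L = s ++ wpow S m ++ t) (h2 : L = t ++ wpow S m ++ s) : False := by
  have := List.length_pos_iff.2 ht
  have hl := congrArg List.length h1
  simp only [List.length_append] at hl
  refine hm.false_of_relation s t S hs ht hS (by omega) (Gen.of_mem (by simp)) ?_
    (wpow S m ++ t) (wpow S m ++ s) ?_ ?_ (by simpa using h1.symm.trans h2)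
  · rw [h1]
    repeat' first | apply Gen.append | apply Gen.wpow | exact Gen.of_mem (by simp)
  all_goals repeat' first | apply Gen.append | apply Gen.wpow | exact Gen.of_mem (by simp)

theorem MinimalPair.false_of_shift (hm : MinimalPair S L) (hS : S ≠ [])
    {s t : List A} (hs : s ≠ []) (ht : t ≠ []) (m n : ℕ)
    (h1 : L = s ++ t) (h2 : t ++ wpow S m ++ s = s ++ t ++ wpow S n) : False := by
  have := List.length_pos_iff.2 hs
  have hl := congrArg List.length h1
  simp only [List.length_append] at hl
  refine hm.false_of_relation t s S ht hs hS (by omega) (Gen.of_mem (by simp)) ?_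
    (wpow S m ++ s) (t ++ wpow S n) ?_ ?_ (by simpa using h2)
  · rw [h1]
    repeat' first | apply Gen.append | apply Gen.wpow | exact Gen.of_mem (by simp)
  all_goals repeat' first | apply Gen.append | apply Gen.wpow | exact Gen.of_mem (by simp)

theorem MinimalPair.false_of_cover_long_short (hm : MinimalPair S L) (hL : L ≠ [])
    {s₁ s₂ r l : List A} (hs₁ : s₁ ≠ []) (hs₂ : s₂ ≠ []) (hr : r ≠ []) (hl : l ≠ []) (n : ℕ)
    (hS : S = s₁ ++ r) (hS' : S = l ++ s₂) (hLe : L = s₂ ++ wpow S n ++ s₁)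
    (h : s₂ ++ l = r ++ s₁) : False := by
  have hL0 := List.length_pos_iff.2 hL
  rcases List.append_eq_append_iff.1 h with ⟨z, rfl, rfl⟩ | ⟨z, rfl, rfl⟩
  · have e1 := congrArg List.length hS
    simp only [List.length_append] at e1
    have hSg : ∀ X : Set (List A), Gen X z → Gen X s₁ → Gen X s₂ → Gen X S := by
      intro X h1 h2 h3
      rw [hS]
      exact h2.append (h3.append h1)
    have hLg : ∀ X : Set (List A), Gen X z → Gen X s₁ → Gen X s₂ → Gen X L := by
      intro X h1 h2 h3
      rw [hLe]
      exact (h3.append ((hSg X h1 h2 h3).wpow n)).append h2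
    by_cases hz : z = []
    · refine hm.false_of_pair s₁ s₂ (by omega) (hSg _ ?_ ?_ ?_) (hLg _ ?_ ?_ ?_)
      all_goals first | exact hz ▸ Gen.nil _ | exact Gen.of_mem (by simp)
    · refine hm.false_of_relation z s₁ s₂ hz hs₁ hs₂ (by omega) (hSg _ ?_ ?_ ?_) (hLg _ ?_ ?_ ?_)
        (s₁ ++ s₂) (s₂ ++ z) ?_ ?_ (by simpa using hS'.symm.trans hS)
      all_goals
        repeat' first | apply Gen.append | exact Gen.of_mem (by simp)
  · have e1 := congrArg List.length hS
    simp only [List.length_append] at e1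
    have hSg : ∀ X : Set (List A), Gen X z → Gen X l → Gen X r → Gen X S := by
      intro X h1 h2 h3
      rw [hS]
      exact (h1.append h2).append h3
    have hLg : ∀ X : Set (List A), Gen X z → Gen X l → Gen X r → Gen X L := by
      intro X h1 h2 h3
      rw [hLe]
      exact ((h3.append h1).append ((hSg X h1 h2 h3).wpow n)).append (h1.append h2)
    by_cases hz : z = []
    · refine hm.false_of_pair l r (by omega) (hSg _ ?_ ?_ ?_) (hLg _ ?_ ?_ ?_)
      all_goals first | exact hz ▸ Gen.nil _ | exact Gen.of_mem (by simp)
    · refine hm.false_of_relation z l r hz hl hr (by omega) (hSg _ ?_ ?_ ?_) (hLg _ ?_ ?_ ?_)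
        (l ++ r) (r ++ z) ?_ ?_ (by simpa using hS.symm.trans hS')
      all_goals
        repeat' first | apply Gen.append | exact Gen.of_mem (by simp)

theorem MinimalPair.false_of_cover_long_long (hm : MinimalPair S L) (hle : S.length ≤ L.length)
    {s₁ s₂ r l t : List A} (hs₁ : s₁ ≠ []) (hs₂ : s₂ ≠ []) (hr : r ≠ []) (hl : l ≠ []) (n : ℕ)
    (hS : S = s₁ ++ r) (hS' : S = l ++ s₂) (hLe : L = s₂ ++ wpow S n ++ s₁)
    (h : L = r ++ t) (ht : t <+: L) : False := by
  have e1 := congrArg List.length hS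
  have e2 := congrArg List.length hS'
  have e3 := congrArg List.length hLe
  have e4 := congrArg List.length h
  simp only [List.length_append] at e1 e2 e3 e4
  have hr0 := List.length_pos_iff.2 hr
  rcases List.append_eq_append_iff.1 (hS.symm.trans hS') with ⟨d, rfl, rfl⟩ | ⟨q, rfl, rfl⟩
  · have hSg : ∀ X : Set (List A), Gen X d → Gen X s₁ → Gen X s₂ → Gen X S := by
      intro X h1 h2 h3
      rw [hS]
      exact h2.append (h1.append h3)
    have hLg : ∀ X : Set (List A), Gen X d → Gen X s₁ → Gen X s₂ → Gen X L := by
      intro X h1 h2 h3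
      rw [hLe]
      exact (h3.append ((hSg X h1 h2 h3).wpow n)).append h2
    simp only [List.length_append] at e1 e2 e3 e4 hr0
    by_cases hd : d = []
    · refine hm.false_of_pair s₁ s₂ (by omega) (hSg _ ?_ ?_ ?_) (hLg _ ?_ ?_ ?_)
      all_goals first | exact hd ▸ Gen.nil _ | exact Gen.of_mem (by simp)
    have hd0 := List.length_pos_iff.2 hd
    cases n with
    | zero => simp [wpow_zero] at e3; omega
    | succ n =>
      have hL2 : L = (s₂ ++ s₁) ++ (d ++ s₂ ++ wpow S n ++ s₁) := by
        conv_lhs => rw [hLe, wpow_succ]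
        conv_lhs => rw [show S ++ wpow S n = (s₁ ++ (d ++ s₂)) ++ wpow S n from by rw [← hS]]
        simp
      have e5 := congrArg List.length hL2
      simp only [List.length_append] at e5
      obtain ⟨t', rfl⟩ : s₂ ++ s₁ <+: t :=
        List.prefix_of_prefix_length_le ⟨_, hL2.symm⟩ ht (by simp; omega)
      have h6 : s₂ ++ (s₁ ++ (d ++ s₂)) = d ++ (s₂ ++ (s₂ ++ s₁)) := by
        have := hL2.symm.trans h
        rw [show (s₂ ++ s₁) ++ (d ++ s₂ ++ wpow S n ++ s₁) =
          (s₂ ++ (s₁ ++ (d ++ s₂))) ++ (wpow S n ++ s₁) by simp,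
          show d ++ s₂ ++ (s₂ ++ s₁ ++ t') = (d ++ (s₂ ++ (s₂ ++ s₁))) ++ t' by simp] at this
        exact (List.append_inj this (by simp; omega)).1
      refine hm.false_of_relation d s₂ s₁ hd hs₂ hs₁ (by omega) (hSg _ ?_ ?_ ?_)
        (hLg _ ?_ ?_ ?_) (s₂ ++ (s₂ ++ s₁)) (s₁ ++ (d ++ s₂)) ?_ ?_ h6.symm
      all_goals
        repeat' first | apply Gen.append | exact Gen.of_mem (by simp)
  · have hSg : ∀ X : Set (List A), Gen X q → Gen X l → Gen X r → Gen X S := by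
      intro X h1 h2 h3
      rw [hS]
      exact (h2.append h1).append h3
    have hLg : ∀ X : Set (List A), Gen X q → Gen X l → Gen X r → Gen X L := by
      intro X h1 h2 h3
      rw [hLe]
      exact ((h1.append h3).append ((hSg X h1 h2 h3).wpow n)).append (h2.append h1)
    simp only [List.length_append] at e1 e2 e3 e4
    by_cases hq : q = []
    · refine hm.false_of_pair l r (by omega) (hSg _ ?_ ?_ ?_) (hLg _ ?_ ?_ ?_)
      all_goals first | exact hq ▸ Gen.nil _ | exact Gen.of_mem (by simp)
    · have hL2 : L = q ++ (r ++ (wpow S n ++ (l ++ q))) := by rw [hLe]; simp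
      obtain ⟨t', rfl⟩ : q <+: t :=
        List.prefix_of_prefix_length_le ⟨_, hL2.symm⟩ ht (by omega)
      have h6 : q ++ r = r ++ q := by
        have := hL2.symm.trans h
        rw [← List.append_assoc, ← List.append_assoc r] at this
        exact (List.append_inj this (by simp; omega)).1
      refine hm.false_of_relation q r l hq hr hl (by omega) (hSg _ ?_ ?_ ?_)
        (hLg _ ?_ ?_ ?_) r q ?_ ?_ h6
      all_goals
        repeat' first | apply Gen.append | exact Gen.of_mem (by simp)

theorem MinimalPair.false_of_cover_short_short (hm : MinimalPair S L)
    {s₁ s₂ r l g : List A} (hs₁ : s₁ ≠ []) (hs₂ : s₂ ≠ []) (hr : r ≠ []) (hl : l ≠ []) (n : ℕ)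
    (hS : S = s₁ ++ r) (hS' : S = l ++ s₂) (hLe : L = s₂ ++ wpow S n ++ s₁)
    (hg : S = r ++ g) (h : g ++ r = s₂ ++ l) : False := by
  classical
  have e1 := congrArg List.length hS
  have e2 := congrArg List.length hS'
  have e3 := congrArg List.length hLe
  have e4 := congrArg List.length hg
  simp only [List.length_append] at e1 e2 e3 e4
  have hs0 := List.length_pos_iff.2 hs₁
  have hr0 := List.length_pos_iff.2 hr
  have hs20 := List.length_pos_iff.2 hs₂
  have hl0 := List.length_pos_iff.2 hl
  have base : g = s₂ → False := by
    rintro rfl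
    have hSg : Gen {s₁, r, g} S := by
      rw [hS]
      repeat' first | apply Gen.append | exact Gen.of_mem (by simp)
    refine hm.false_of_relation s₁ r g hs₁ hr hs₂ (by omega) hSg ?_ r g ?_ ?_
      (hS.symm.trans hg)
    · rw [hLe]
      repeat' first | apply Gen.append | exact hSg.wpow n | exact Gen.of_mem (by simp)
    all_goals exact Gen.of_mem (by simp)
  rcases List.append_eq_append_iff.1 h with ⟨z, rfl, rfl⟩ | ⟨z, rfl, rfl⟩
  · by_cases hz : z = []
    · exact base (by simp [hz])
    have hg0 : g ≠ [] := by
      rintro rfl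
      rw [List.length_nil] at e4
      omega
    have hSg : Gen ({z, l, g, s₁} : Set (List A)) S := by
      rw [hg]
      repeat' first | apply Gen.append | exact Gen.of_mem (by simp)
    simp only [List.length_append] at e1 e2 e3 e4
    refine hm.false_of_relations {z, l, g, s₁}
      (by simp [Ne.symm hz, hg0.symm, hl.symm, hs₁.symm]) (c := z) (d := g) (by simp) (by simp)
      (by omega) (by simpa using hSg) ?_ ?_
    · have : Gen ({z, l, g, s₁} : Set (List A)) L := by
        rw [hLe]
        repeat' first | apply Gen.append | exact hSg.wpow n | exact Gen.of_mem (by simp)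
      simpa using this
    · intro f hf w hw
      have h1 : f z = f l := by
        refine hf z (by simp) l (by simp) (l ++ g) (g ++ z) ?_ ?_
          (by simpa using hg.symm.trans hS')
        all_goals repeat' first | apply Gen.append | exact Gen.of_mem (by simp)
      have h2 : f s₁ = f z := by
        refine hf s₁ (by simp) z (by simp) (z ++ l) (l ++ g) ?_ ?_
          (by simpa using hS.symm.trans hg)
        all_goals repeat' first | apply Gen.append | exact Gen.of_mem (by simp)
      simp only [Finset.mem_insert, Finset.mem_singleton] at hw
      rcases hw with rfl | rfl | rfl | rfl <;> simp [h1, h2]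
  · by_cases hz : z = []
    · exact base (by simp [hz])
    have hSg : Gen ({z, r, s₂, s₁} : Set (List A)) S := by
      rw [hS]
      repeat' first | apply Gen.append | exact Gen.of_mem (by simp)
    simp only [List.length_append] at e1 e2 e3 e4
    refine hm.false_of_relations {z, r, s₂, s₁}
      (by simp [Ne.symm hz, hr.symm, hs₂.symm, hs₁.symm]) (c := r) (d := s₂) (by simp) (by simp)
      (by omega) (by simpa using hSg) ?_ ?_
    · have : Gen ({z, r, s₂, s₁} : Set (List A)) L := by
        rw [hLe]
        repeat' first | apply Gen.append | exact hSg.wpow n | exact Gen.of_mem (by simp)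
      simpa using this
    · intro f hf w hw
      have h1 : f z = f r := by
        refine hf z (by simp) r (by simp) (r ++ s₂) (s₂ ++ z) ?_ ?_
          (by simpa using hS'.symm.trans hg)
        all_goals repeat' first | apply Gen.append | exact Gen.of_mem (by simp)
      have h2 : f s₁ = f r := by
        refine hf s₁ (by simp) r (by simp) r (s₂ ++ z) ?_ ?_
          (by simpa using hS.symm.trans hg)
        all_goals repeat' first | apply Gen.append | exact Gen.of_mem (by simp)
      simp only [Finset.mem_insert, Finset.mem_singleton] at hw
      rcases hw with rfl | rfl | rfl | rfl <;> simp [h1, h2]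

theorem MinimalPair.false_of_conj (hm : MinimalPair S L) (hL : L ≠ []) {s r g t : List A}
    (hs : s ≠ []) (hr : r ≠ []) (h1 : S = s ++ r) (h2 : S = r ++ g)
    (h3 : L = g ++ t) (h4 : L = t ++ s) : False := by
  have hL0 := List.length_pos_iff.2 hL
  have hs0 := List.length_pos_iff.2 hs
  have e1 := congrArg List.length h1
  have e4 := congrArg List.length h4
  simp only [List.length_append] at e1 e4
  by_cases ht : t = []
  · subst ht
    exact hm.false_of_pair r s (by omega)
      (h1 ▸ (Gen.of_mem (by simp)).append (Gen.of_mem (by simp)))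
      (h4 ▸ (Gen.nil _).append (Gen.of_mem (by simp)))
  · refine hm.false_of_relation r s t hr hs ht (by omega)
      (h1 ▸ (Gen.of_mem (by simp)).append (Gen.of_mem (by simp)))
      (h4 ▸ (Gen.of_mem (by simp)).append (Gen.of_mem (by simp))) (t ++ s) (r ++ t) ?_ ?_ ?_
    · exact (Gen.of_mem (by simp)).append (Gen.of_mem (by simp))
    · exact (Gen.of_mem (by simp)).append (Gen.of_mem (by simp))
    · rw [← h4, ← List.append_assoc s, ← h1, h2, h3, List.append_assoc]

theorem MinimalPair.false_of_comm_tail (hm : MinimalPair S L) (hL : L ≠ []) {r g t : List A}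
    (hr : r ≠ []) (hg : g ≠ []) (h2 : S = r ++ g) (h3 : L = g ++ t) (h4 : L = t ++ g) :
    False := by
  have hL0 := List.length_pos_iff.2 hL
  have hg0 := List.length_pos_iff.2 hg
  have e2 := congrArg List.length h2
  have e3 := congrArg List.length h3
  simp only [List.length_append] at e2 e3
  by_cases ht : t = []
  · subst ht
    exact hm.false_of_pair r g (by omega)
      (h2 ▸ (Gen.of_mem (by simp)).append (Gen.of_mem (by simp)))
      (h4 ▸ (Gen.nil _).append (Gen.of_mem (by simp)))
  · exact hm.false_of_relation g t r hg ht hr (by omega)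
      (h2 ▸ (Gen.of_mem (by simp)).append (Gen.of_mem (by simp)))
      (h4 ▸ (Gen.of_mem (by simp)).append (Gen.of_mem (by simp))) t g (Gen.of_mem (by simp))
      (Gen.of_mem (by simp)) (h3 ▸ h4)

theorem MinimalPair.false_of_cross_aux (hm : MinimalPair S L) {s f t r x y : List A}
    (hs : s ≠ []) (hf : f ≠ []) (ht : t ≠ []) (hr : r ≠ []) (a b : ℕ)
    (hS1 : S = f ++ (s ++ x)) (hS2 : S = y ++ (f ++ s))
    (hL1 : L = s ++ (wpow S a ++ t)) (hL2 : L = t ++ (wpow S a ++ f))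
    (hL3 : L = s ++ (x ++ (wpow S b ++ r))) (hL4 : L = r ++ (wpow S b ++ (y ++ f))) : False := by
  classical
  have hs0 := List.length_pos_iff.2 hs
  have ht0 := List.length_pos_iff.2 ht
  have hf0 := List.length_pos_iff.2 hf
  have e1 := congrArg List.length hS1
  have e3 := congrArg List.length hL1
  simp only [List.length_append] at e1 e3
  by_cases hx : x = []
  · have hSg : Gen {s, t, f} S := by
      rw [hS1, hx]
      repeat' first | apply Gen.append | exact Gen.nil _ | exact Gen.of_mem (by simp)
    refine hm.false_of_relation s t f hs ht hf (by omega) hSg ?_ (wpow S a ++ t)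
      (wpow S a ++ f) ?_ ?_ (hL1.symm.trans hL2)
    · rw [hL1]
      repeat' first | apply Gen.append | exact hSg.wpow a | exact Gen.of_mem (by simp)
    all_goals repeat' first | apply Gen.append | exact hSg.wpow a | exact Gen.of_mem (by simp)
  have hSg : Gen ({x, t, r, f, s} : Set (List A)) S := by
    rw [hS1]
    repeat' first | apply Gen.append | exact Gen.of_mem (by simp)
  refine hm.false_of_relations {x, t, r, f, s}
      (by simp [hs.symm, hf.symm, ht.symm, hr.symm, Ne.symm hx]) (c := s) (d := f) (by simp)
      (by simp) (by omega) (by simpa using hSg) ?_ ?_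
  · have : Gen ({x, t, r, f, s} : Set (List A)) L := by
      rw [hL1]
      repeat' first | apply Gen.append | exact hSg.wpow a | exact Gen.of_mem (by simp)
    simpa using this
  · intro h hf w hw
    have h1 : h s = h t := by
      refine hf s (by simp) t (by simp) _ _ ?_ ?_ (hL1.symm.trans hL2)
      all_goals
        simp only [Finset.coe_insert, Finset.coe_singleton]
        repeat' first | apply Gen.append | exact hSg.wpow a | exact Gen.of_mem (by simp)
    have h2 : h t = h r := by
      have : t ++ (wpow S a ++ (f ++ s)) = r ++ (wpow S b ++ S) := by
        have h3 : L ++ s = L ++ s := rfl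
        conv_lhs at h3 => rw [hL2]
        conv_rhs at h3 => rw [hL4]
        simp only [List.append_assoc] at h3
        rw [h3, ← hS2]
      refine hf t (by simp) r (by simp) _ _ ?_ ?_ this
      all_goals
        simp only [Finset.coe_insert, Finset.coe_singleton]
        repeat' first
        | apply Gen.append | exact hSg.wpow _ | exact hSg | exact Gen.of_mem (by simp)
    have h3 : wpow S a ++ t = x ++ (wpow S b ++ r) :=
      List.append_cancel_left (hL1.symm.trans hL3)
    have h4 : h x = h s ∨ h x = h f := by
      cases a with
      | zero =>
        left
        rw [h1]
        refine hf x (by simp) t (by simp) (wpow S b ++ r) [] ?_ (Gen.nil _)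
          (by simpa [wpow_zero] using h3.symm)
        simp only [Finset.coe_insert, Finset.coe_singleton]
        repeat' first | apply Gen.append | exact hSg.wpow _ | exact Gen.of_mem (by simp)
      | succ a =>
        right
        refine hf x (by simp) f (by simp) (wpow S b ++ r) (s ++ (x ++ (wpow S a ++ t))) ?_ ?_ ?_
        · simp only [Finset.coe_insert, Finset.coe_singleton]
          repeat' first | apply Gen.append | exact hSg.wpow _ | exact Gen.of_mem (by simp)
        · simp only [Finset.coe_insert, Finset.coe_singleton]
          repeat' first | apply Gen.append | exact hSg.wpow _ | exact Gen.of_mem (by simp)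
        · rw [← h3, wpow_succ]
          conv_lhs => rw [List.append_assoc]
          rw [show f ++ (s ++ (x ++ (wpow S a ++ t))) = (f ++ (s ++ x)) ++ (wpow S a ++ t) by
            simp, ← hS1]
    simp only [Finset.mem_insert, Finset.mem_singleton] at hw
    rcases hw with rfl | rfl | rfl | rfl | rfl
    · exact h4
    · exact Or.inl h1.symm
    · exact Or.inl (h1.trans h2).symm
    · exact Or.inr rfl
    · exact Or.inl rfl

theorem MinimalPair.false_of_cross (hm : MinimalPair S L) {s f s' f' t r : List A}
    (hs : s ≠ []) (hf : f ≠ []) (ht : t ≠ []) (hr : r ≠ []) (a b : ℕ)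
    (hS : S = f ++ s) (hf' : f' <+: S) (hs' : s' <:+ S) (hfs : f'.length = s.length)
    (hsf : s'.length = f.length)
    (hL1 : L = s' ++ (wpow S a ++ t)) (hL2 : L = t ++ (wpow S a ++ f))
    (hL3 : L = s ++ (wpow S b ++ r)) (hL4 : L = r ++ (wpow S b ++ f')) : False := by
  have e1 := congrArg List.length hS
  simp only [List.length_append] at e1
  have hS2 : S = f' ++ s' := by
    obtain ⟨p, hp⟩ := hf'
    obtain ⟨q, hq⟩ := hs'
    have e2 := congrArg List.length hp
    have e3 := congrArg List.length hq
    simp only [List.length_append] at e2 e3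
    have := (List.append_inj (hp.trans hq.symm) (by omega)).2
    rw [← hp, this]
  have hs'0 : s' ≠ [] := by
    rw [← List.length_pos_iff, hsf]
    exact List.length_pos_iff.2 hf
  have hf'0 : f' ≠ [] := by
    rw [← List.length_pos_iff, hfs]
    exact List.length_pos_iff.2 hs
  have sf : f <:+ L := ⟨t ++ wpow S a, by rw [List.append_assoc]; exact hL2.symm⟩
  have sf' : f' <:+ L := ⟨r ++ wpow S b, by rw [List.append_assoc]; exact hL4.symm⟩
  rcases le_total f.length s.length with h | h
  · obtain ⟨x, rfl⟩ : s' <+: s :=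
      List.prefix_of_prefix_length_le ⟨_, hL1.symm⟩ ⟨_, hL3.symm⟩ (by omega)
    obtain ⟨y, rfl⟩ : f <:+ f' := List.suffix_of_suffix_length_le sf sf' (by omega)
    exact hm.false_of_cross_aux hs'0 hf ht hr a b hS (by simpa using hS2) hL1 hL2
      (by simpa using hL3) (by simpa using hL4)
  · obtain ⟨x, rfl⟩ : s <+: s' :=
      List.prefix_of_prefix_length_le ⟨_, hL3.symm⟩ ⟨_, hL1.symm⟩ (by omega)
    obtain ⟨y, rfl⟩ : f' <:+ f := List.suffix_of_suffix_length_le sf' sf (by omega)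
    exact hm.false_of_cross_aux hs hf'0 hr ht b a hS2 (by simpa using hS) hL3 hL4
      (by simpa using hL1) (by simpa using hL2)

end Equations

section Positions

variable {A : Type*} {W : ℕ → A} {S L : List A}

/-- The factor of `W` between the positions `x` and `y`. -/
def seg (W : ℕ → A) (x y : ℕ) : List A := factorAt W x (y - x)

/-- The word `P` occurs in `W` at position `x`. -/
def OccAt (W : ℕ → A) (P : List A) (x : ℕ) : Prop := seg W x (x + P.length) = P

theorem length_seg (W : ℕ → A) (x y : ℕ) : (seg W x y).length = y - x := by
  simp [seg, factorAt]

theorem seg_append {x y z : ℕ} (hxy : x ≤ y) (hyz : y ≤ z) :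
    seg W x y ++ seg W y z = seg W x z := by
  obtain ⟨m, rfl⟩ := Nat.exists_eq_add_of_le hxy
  obtain ⟨n, rfl⟩ := Nat.exists_eq_add_of_le hyz
  have h1 : x + m - x = m := by omega
  have h2 : x + m + n - (x + m) = n := by omega
  have h3 : x + m + n - x = m + n := by omega
  simp only [seg, factorAt, h1, h2, h3, List.range_add, List.map_append, List.map_map]
  congr 1
  refine List.map_congr_left fun i _ => ?_
  simp [add_assoc]

theorem seg_ne_nil {x y : ℕ} (h : x < y) : seg W x y ≠ [] := by
  rw [← List.length_pos_iff, length_seg]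
  omega

theorem seg_self (x : ℕ) : seg W x x = [] := by
  rw [← List.length_eq_zero_iff, length_seg]
  omega

theorem seg_congr {x x' y y' a b c d : ℕ} (h : seg W x x' = seg W y y') (ha : x ≤ a)
    (hab : a ≤ b) (hb : b ≤ x') (hc : c + x = a + y) (hd : d + x = b + y) :
    seg W a b = seg W c d := by
  have hl := congrArg List.length h
  rw [length_seg, length_seg] at hl
  by_cases hab' : a = b
  · subst hab'
    have : c = d := by omega
    subst this
    rw [seg_self, seg_self]
  rw [← seg_append ha (hab.trans hb), ← seg_append hab hb,
    ← seg_append (show y ≤ c by omega) (show c ≤ y' by omega),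
    ← seg_append (show c ≤ d by omega) (show d ≤ y' by omega)] at h
  have h1 := (List.append_inj h (by rw [length_seg, length_seg]; omega)).2
  exact (List.append_inj h1 (by rw [length_seg, length_seg]; omega)).1

theorem OccAt.seg_eq {P : List A} {x y a b c d : ℕ} (h : OccAt W P x) (h' : OccAt W P y)
    (ha : x ≤ a) (hab : a ≤ b) (hb : b ≤ x + P.length) (hc : c + x = a + y)
    (hd : d + x = b + y) : seg W a b = seg W c d :=
  seg_congr (h.trans h'.symm) ha hab hb hc hd

theorem OccAt.eq_append {P : List A} {x y z : ℕ} (h : OccAt W P x) (hxy : x ≤ y)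
    (hz : z = x + P.length) (hyz : y ≤ z) : P = seg W x y ++ seg W y z := by
  rw [seg_append hxy hyz, hz]
  exact h.symm

theorem OccAt.seg_prefix_of_le {P : List A} {x y : ℕ} (h : OccAt W P x) (hxy : x ≤ y)
    (hy : y ≤ x + P.length) : seg W x y <+: P :=
  ⟨_, (h.eq_append hxy rfl hy).symm⟩

theorem OccAt.seg_suffix {P : List A} {x y z : ℕ} (h : OccAt W P x) (hxy : x ≤ y)
    (hz : z = x + P.length) (hyz : y ≤ z) : seg W y z <:+ P :=
  ⟨_, (h.eq_append hxy hz hyz).symm⟩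

theorem seg_eq_wpow {a : ℕ} (m : ℕ) (h : ∀ j < m, OccAt W S (a + j * S.length)) :
    seg W a (a + m * S.length) = wpow S m := by
  induction m with
  | zero => simp [seg_self, wpow_zero]
  | succ m ih =>
    rw [wpow_succ', ← ih fun j hj => h j (by omega), Nat.succ_mul, ← add_assoc,
      ← seg_append (show a ≤ a + m * S.length by omega)
        (show a + m * S.length ≤ a + m * S.length + S.length by omega)]
    congr 1
    exact h m (by omega)

/-- The standing assumptions on the short word `S` and the long word `L`. -/
structure ShortLong (S L : List A) : Prop where
  minimal : MinimalPair S L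
  short_ne : S ≠ []
  long_ne : L ≠ []
  le : S.length ≤ L.length

theorem ShortLong.short_pos (h : ShortLong S L) : 0 < S.length := List.length_pos_iff.2 h.short_ne

theorem ShortLong.not_occAt (h : ShortLong S L) {x : ℕ} (hS : OccAt W S x) (hL : OccAt W L x) :
    False :=
  h.minimal.not_prefix_long h.short_ne
    (hS ▸ hL.seg_prefix_of_le (Nat.le_add_right _ _) (Nat.add_le_add_left h.le _))

theorem ShortLong.not_suffix_occAt (h : ShortLong S L) {x y : ℕ} (hS : OccAt W S x)
    (hL : OccAt W L y) (hxy : x + S.length = y + L.length) : False := by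
  have := hL.seg_suffix (y := x) (z := x + S.length) (by have := h.le; omega) hxy
    (Nat.le_add_right _ _)
  rw [show seg W x (x + S.length) = S from hS] at this
  exact h.minimal.not_suffix h.short_ne this

theorem ShortLong.not_inner (h : ShortLong S L) {x y : ℕ} (h1 : OccAt W S y)
    (h2 : OccAt W S (y + S.length)) (hx : OccAt W S x) (hyx : y < x) (hxy : x < y + S.length) :
    False := by
  refine h.minimal.false_of_comm h.long_ne (seg_ne_nil hyx) (seg_ne_nil (W := W) hxy)
    (h1.eq_append hyx.le rfl hxy.le) ?_
  refine (hx.eq_append hxy.le rfl (by omega)).trans (congrArg _ ?_)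
  exact h2.seg_eq h1 le_rfl (by omega) (by omega) (by omega) (by omega)

/-- A factorization of `W` between `lo` and `hi` into blocks `S` and `L`, given by the set of
the boundaries of the blocks. -/
structure Chain (W : ℕ → A) (S L : List A) (B : ℕ → Prop) (lo hi : ℕ) : Prop where
  lo_mem : B lo
  lo_le : ∀ x, B x → lo ≤ x
  le_hi : ∀ x, B x → x ≤ hi
  next : ∀ x, B x → x < hi →
    OccAt W S x ∧ B (x + S.length) ∨ OccAt W L x ∧ B (x + L.length)
  sepS : ∀ x y, B x → B y → x < y → OccAt W S x → x + S.length ≤ y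
  sepL : ∀ x y, B x → B y → x < y → OccAt W L x → x + L.length ≤ y

/-- A block `L` starts at the boundary `x`. -/
def LBlock (W : ℕ → A) (L : List A) (B : ℕ → Prop) (hi x : ℕ) : Prop :=
  B x ∧ x < hi ∧ OccAt W L x

/-- `p` and `p'` are the beginnings of consecutive blocks `L`. -/
def Consec (W : ℕ → A) (L : List A) (B : ℕ → Prop) (hi p p' : ℕ) : Prop :=
  LBlock W L B hi p ∧ LBlock W L B hi p' ∧ p < p' ∧ ∀ x, LBlock W L B hi x → x ≤ p ∨ p' ≤ x

variable {B : ℕ → Prop} {lo hi : ℕ}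

theorem Chain.next_long (C : Chain W S L B lo hi) (h : ShortLong S L) {x : ℕ}
    (hx : LBlock W L B hi x) : B (x + L.length) := by
  rcases C.next x hx.1 hx.2.1 with h1 | h1
  · exact (h.not_occAt h1.1 hx.2.2).elim
  · exact h1.2

theorem Chain.next_short (C : Chain W S L B lo hi) {x : ℕ}
    (hx : B x) (hlt : x < hi) (hL : ¬ LBlock W L B hi x) :
    OccAt W S x ∧ B (x + S.length) := by
  rcases C.next x hx hlt with h1 | h1
  · exact h1
  · exact (hL ⟨hx, hlt, h1.1⟩).elim

theorem Chain.exists_last (C : Chain W S L B lo hi) {x : ℕ} (hx : lo ≤ x) :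
    ∃ y, B y ∧ y ≤ x ∧ ∀ z, B z → z ≤ x → z ≤ y := by
  classical
  have hne : ((Finset.range (x + 1)).filter B).Nonempty :=
    ⟨lo, by simp only [Finset.mem_filter, Finset.mem_range]; exact ⟨by omega, C.lo_mem⟩⟩
  have hmem := Finset.max'_mem _ hne
  simp only [Finset.mem_filter, Finset.mem_range] at hmem
  refine ⟨_, hmem.2, by omega, fun z hz hzx => Finset.le_max' _ z ?_⟩
  simp only [Finset.mem_filter, Finset.mem_range]
  exact ⟨by omega, hz⟩

theorem Chain.prev (C : Chain W S L B lo hi) (h : ShortLong S L) {x : ℕ} (hx : B x)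
    (hlo : lo < x) : ∃ y, B y ∧ y < x ∧ (OccAt W S y ∧ y + S.length = x ∨
      LBlock W L B hi y ∧ y + L.length = x) := by
  have h0 := h.short_pos
  have h1 := h.le
  obtain ⟨y, hy, hyx, hmax⟩ := C.exists_last (show lo ≤ x - 1 by omega)
  have hhi := C.le_hi x hx
  have hlt : y < x := by omega
  refine ⟨y, hy, hlt, ?_⟩
  rcases C.next y hy (by omega) with ⟨h2, h3⟩ | ⟨h2, h3⟩
  · have h4 := C.sepS y x hy hx hlt h2
    have h5 := hmax _ h3
    exact Or.inl ⟨h2, by omega⟩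
  · have h4 := C.sepL y x hy hx hlt h2
    have h5 := hmax _ h3
    exact Or.inr ⟨⟨hy, by omega, h2⟩, by omega⟩

theorem Chain.run (C : Chain W S L B lo hi) (h : ShortLong S L) {a y : ℕ} (ha : B a) (hy : B y)
    (hay : a ≤ y) (hno : ∀ x, LBlock W L B hi x → a ≤ x → y ≤ x) :
    ∃ m, y = a + m * S.length ∧ ∀ j < m, OccAt W S (a + j * S.length) := by
  obtain ⟨n, hn⟩ : ∃ n, y - a = n := ⟨_, rfl⟩
  induction n using Nat.strong_induction_on generalizing a with
  | _ n ih =>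
    have h0 := h.short_pos
    rcases hay.eq_or_lt with rfl | hlt
    · exact ⟨0, by simp, by simp⟩
    have hhi := C.le_hi y hy
    have h2 := C.next_short ha (by omega) fun hL => by
      have := hno a hL le_rfl
      omega
    have h3 := C.sepS a y ha hy hlt h2.1
    obtain ⟨m, hm, hm'⟩ := ih (y - (a + S.length)) (by omega) h2.2 h3
      (fun x hx hax => hno x hx (by omega)) rfl
    refine ⟨m + 1, by rw [hm, Nat.succ_mul]; omega, ?_⟩
    intro j hj
    cases j with
    | zero => simpa using h2.1
    | succ j =>
      have := hm' j (by omega)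
      rwa [show a + (j + 1) * S.length = a + S.length + j * S.length by
        rw [Nat.succ_mul]; omega]

theorem Consec.long_le (C : Chain W S L B lo hi) {p p' : ℕ} (hp : Consec W L B hi p p') :
    p + L.length ≤ p' :=
  C.sepL p p' hp.1.1 hp.2.1.1 hp.2.2.1 hp.1.2.2

theorem Consec.run (C : Chain W S L B lo hi) (h : ShortLong S L) {p p' : ℕ}
    (hp : Consec W L B hi p p') : ∃ m, p' = p + L.length + m * S.length ∧
      ∀ j < m, OccAt W S (p + L.length + j * S.length) := by
  have h0 := h.short_pos
  have h1 := h.le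
  refine C.run h (C.next_long h hp.1) hp.2.1.1 (hp.long_le C) fun x hx hpx => ?_
  have := hp.2.2.2 x hx
  omega

theorem exists_consec {p p' : ℕ} (hp : LBlock W L B hi p) (hp' : LBlock W L B hi p')
    (hlt : p < p') : ∃ q, Consec W L B hi p q ∧ q ≤ p' := by
  classical
  have hex : ∃ q, p < q ∧ LBlock W L B hi q := ⟨p', hlt, hp'⟩
  refine ⟨Nat.find hex, ⟨hp, (Nat.find_spec hex).2, (Nat.find_spec hex).1, fun x hx => ?_⟩,
    Nat.find_min' hex ⟨hlt, hp'⟩⟩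
  by_contra hcon
  push Not at hcon
  exact absurd (Nat.find_min' hex ⟨hcon.1, hx⟩) (by omega)

end Positions

section Touching

variable {A : Type*} {W : ℕ → A} {S L : List A} {B₁ B₂ : ℕ → Prop} {lo₁ hi₁ lo₂ hi₂ : ℕ}

/-- Two factorizations of `W` into blocks without common boundaries. -/
structure TwoChains (W : ℕ → A) (S L : List A) (B₁ : ℕ → Prop) (lo₁ hi₁ : ℕ)
    (B₂ : ℕ → Prop) (lo₂ hi₂ : ℕ) : Prop where
  short : ShortLong S L
  fst : Chain W S L B₁ lo₁ hi₁
  snd : Chain W S L B₂ lo₂ hi₂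
  disj : ∀ x, B₁ x → B₂ x → False

theorem TwoChains.symm (T : TwoChains W S L B₁ lo₁ hi₁ B₂ lo₂ hi₂) :
    TwoChains W S L B₂ lo₂ hi₂ B₁ lo₁ hi₁ :=
  ⟨T.short, T.snd, T.fst, fun x h1 h2 => T.disj x h2 h1⟩

theorem TwoChains.not_touch_two (T : TwoChains W S L B₁ lo₁ hi₁ B₂ lo₂ hi₂) {p p' q : ℕ}
    (hp : LBlock W L B₁ hi₁ p) (hp' : LBlock W L B₁ hi₁ p') (hlt : p < p')
    (hq : LBlock W L B₂ hi₂ q) (h1 : q < p + L.length) (h2 : p' < q + L.length)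
    (hhi : p' + L.length ≤ hi₂) : False := by
  obtain ⟨r, hc, hle⟩ := exists_consec hp hp' hlt
  obtain ⟨m, hm, hrun⟩ := hc.run T.fst T.short
  have hpos := T.short.short_pos
  have hSL := T.short.le
  have hpr := hc.long_le T.fst
  have step : ∀ j ≤ m, B₂ (q + L.length + j * S.length) ∧
      ∀ i < j, OccAt W S (q + L.length + i * S.length) := by
    intro j
    induction j with
    | zero => exact fun _ => ⟨by simpa using T.snd.next_long T.short hq, by simp⟩
    | succ j ih =>
      intro hj
      obtain ⟨h3, h4⟩ := ih (by omega)
      obtain ⟨k, rfl⟩ := Nat.exists_eq_add_of_le hj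
      have hmul : (j + 1 + k) * S.length = j * S.length + S.length + k * S.length := by ring
      have hmul' : (j + 1) * S.length = j * S.length + S.length := by ring
      have hlt' : q + L.length + j * S.length < hi₂ := by omega
      have hnL : ¬ LBlock W L B₂ hi₂ (q + L.length + j * S.length) := by
        intro hL
        have hz := hL.2.2.seg_eq hq.2.2
          (a := p + L.length + L.length + j * S.length + k * S.length)
          (b := p + L.length + L.length + j * S.length + k * S.length + S.length)
          (c := p + L.length + k * S.length) (d := p + L.length + k * S.length + S.length)
          (by omega) (by omega) (by omega) (by omega) (by omega)
        exact T.short.not_suffix_occAt (hz.trans (hrun k (by omega))) hc.2.1.2.2 (by omega)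
      obtain ⟨h5, h6⟩ := T.snd.next_short h3 hlt' hnL
      refine ⟨by rwa [hmul', ← add_assoc], fun i hi => ?_⟩
      rcases Nat.lt_succ_iff_lt_or_eq.1 hi with hi | rfl
      · exact h4 i hi
      · exact h5
  refine T.short.minimal.false_of_swap T.short.short_ne (s := seg W q (p + L.length))
    (t := seg W r (q + L.length)) (seg_ne_nil h1) (seg_ne_nil (by omega)) m ?_ ?_
  · rw [← seg_eq_wpow m hrun, ← hm, seg_append h1.le hpr, seg_append (by omega) (by omega)]
    exact hq.2.2.symm
  · rw [← seg_eq_wpow m (step m le_rfl).2, seg_append (by omega) (by omega)]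
    have := hc.2.1.2.2.seg_eq hp.2.2 (a := q + L.length + m * S.length) (b := r + L.length)
      (c := q) (d := p + L.length) (by omega) (by omega) (by omega) (by omega) (by omega)
    rw [← this, seg_append (by omega) (by omega)]
    exact hc.2.1.2.2.symm

theorem TwoChains.exists_touch (T : TwoChains W S L B₁ lo₁ hi₁ B₂ lo₂ hi₂) {p : ℕ}
    (hp : LBlock W L B₁ hi₁ p) (hlo : lo₂ ≤ p) (hh₁ : p + 3 * L.length ≤ hi₁)
    (hh₂ : p + 3 * L.length ≤ hi₂) :
    ∃ q, LBlock W L B₂ hi₂ q ∧ q < p + L.length ∧ p < q + L.length := by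
  by_contra! hno
  have hpos := T.short.short_pos
  have hSL := T.short.le
  have hpL := T.fst.next_long T.short hp
  have hne : ∀ x, B₁ x → ∀ y, B₂ y → x ≠ y := by
    rintro x hx y hy rfl
    exact T.disj x hx hy
  obtain ⟨a, ha, hap, hamax⟩ := T.snd.exists_last hlo
  have hap' := hne p hp.1 a ha
  obtain ⟨haS, haB⟩ := T.snd.next_short ha (by omega) fun hL => by
    have h1 := hno a hL (by omega)
    have h2 := hamax _ (T.snd.next_long T.short hL) h1
    omega
  have haσ := hamax _ haB
  have haσ' := hne p hp.1 _ haB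
  obtain ⟨y, hy, hyp, hymax⟩ := T.snd.exists_last (show lo₂ ≤ p + L.length by omega)
  have hyp' := hne _ hpL y hy
  have hay := hymax _ haB (by omega)
  obtain ⟨hyS, hyB⟩ := T.snd.next_short hy (by omega) fun hL => by
    have := hno y hL (by omega)
    omega
  have hyσ := hymax _ hyB
  have hyσ' := hne _ hpL _ hyB
  obtain ⟨n, hn, hrun⟩ := T.snd.run T.short haB hy hay fun x hx hax => by
    have := hno x hx
    omega
  have hwp := seg_eq_wpow n hrun
  rw [← hn] at hwp
  have haS2 : OccAt W S (a + S.length) := by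
    cases n with
    | zero => rwa [show a + S.length = y by omega]
    | succ n => simpa using hrun 0 (by omega)
  -- the pieces of the covering of the block at `p`
  have e1 : S = seg W y (p + L.length) ++ seg W (p + L.length) (y + S.length) :=
    hyS.eq_append hyp rfl (by omega)
  have e2 : S = seg W a p ++ seg W p (a + S.length) := haS.eq_append hap rfl (by omega)
  have e3 : L = seg W p (a + S.length) ++ wpow S n ++ seg W y (p + L.length) := by
    rw [← hwp, seg_append (by omega) hay, seg_append (by omega) hyp]
    exact hp.2.2.symm
  have n1 : seg W y (p + L.length) ≠ [] := seg_ne_nil (by omega)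
  have n2 : seg W p (a + S.length) ≠ [] := seg_ne_nil (by omega)
  have n3 : seg W (p + L.length) (y + S.length) ≠ [] := seg_ne_nil (by omega)
  have n4 : seg W a p ≠ [] := seg_ne_nil (by omega)
  have e4 : seg W p (a + S.length) ++ seg W a p = seg W p (p + S.length) := by
    rw [← seg_append (show p ≤ a + S.length by omega) (show a + S.length ≤ p + S.length by omega)]
    congr 1
    exact haS.seg_eq haS2 le_rfl (by omega) (by omega) (by omega) (by omega)
  rcases T.fst.next _ hpL (by omega) with ⟨hX, hXB⟩ | ⟨hX, hXB⟩ <;>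
    rcases T.snd.next _ hyB (by omega) with ⟨hY, hYB⟩ | ⟨hY, hYB⟩
  · exact T.short.not_inner hyS hY hX (by omega) (by omega)
  · have e5 : S = seg W (p + L.length) (y + S.length) ++
        seg W (y + S.length) (p + L.length + S.length) :=
      hX.eq_append (by omega) rfl (by omega)
    rcases T.fst.next _ hXB (by omega) with ⟨hX2, -⟩ | ⟨hX2, -⟩
    · refine T.short.minimal.false_of_cover_short_short n1 n2 n3 n4 n e1 e2 e3 e5 ?_
      rw [e4, hX.seg_eq hX2 le_rfl (by omega) (by omega)
        (c := p + L.length + S.length) (d := y + S.length + S.length) (by omega) (by omega),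
        seg_append (by omega) (by omega)]
      exact hY.seg_eq hp.2.2 le_rfl (by omega) (by omega) (by omega) (by omega)
    · have e6 : L = seg W (y + S.length) (p + L.length + S.length) ++
          seg W (p + L.length + S.length) (y + S.length + L.length) :=
        hY.eq_append (by omega) rfl (by omega)
      have e7 : L = seg W (p + L.length + S.length) (y + S.length + L.length) ++
          seg W (y + S.length + L.length) (p + L.length + S.length + L.length) :=
        hX2.eq_append (by omega) rfl (by omega)
      rcases T.snd.next _ hYB (by omega) with ⟨hZ, -⟩ | ⟨hZ, -⟩
      · rw [hZ.seg_eq hyS (c := y) (d := p + L.length) le_rfl (by omega) (by omega) (by omega)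
          (by omega)] at e7
        exact T.short.minimal.false_of_conj T.short.long_ne n1 n3 e1 e5 e6 e7
      · rw [hZ.seg_eq hY (c := y + S.length) (d := p + L.length + S.length) le_rfl (by omega)
          (by omega) (by omega) (by omega)] at e7
        exact T.short.minimal.false_of_comm_tail T.short.long_ne n3 (seg_ne_nil (by omega))
          e5 e6 e7
  · refine T.short.minimal.false_of_cover_long_short T.short.long_ne n1 n2 n3 n4 n e1 e2 e3 ?_
    rw [e4, hyS.seg_eq hY (c := y + S.length) (d := p + L.length + S.length) le_rfl (by omega)
      (by omega) (by omega) (by omega), seg_append (by omega) (by omega)]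
    exact hp.2.2.seg_eq hX le_rfl (by omega) (by omega) (by omega) (by omega)
  · refine T.short.minimal.false_of_cover_long_long T.short.le n1 n2 n3 n4 n e1 e2 e3
      (hX.eq_append (by omega) rfl (by omega)) ?_
    exact hY.seg_prefix_of_le (by omega) (by omega)

theorem TwoChains.exists_consec_touch (T : TwoChains W S L B₁ lo₁ hi₁ B₂ lo₂ hi₂) {p p' : ℕ}
    (hp : Consec W L B₁ hi₁ p p') (hlo : lo₂ ≤ p) (hh₁ : p' + 3 * L.length ≤ hi₁)
    (hh₂ : p' + 3 * L.length ≤ hi₂) :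
    ∃ q q', Consec W L B₂ hi₂ q q' ∧ q < p + L.length ∧ p < q + L.length ∧
      q' < p' + L.length ∧ p' < q' + L.length := by
  have hpp := hp.long_le T.fst
  have hlo₁ := T.fst.lo_le p hp.1.1
  obtain ⟨q, hq, h1, h2⟩ := T.exists_touch hp.1 hlo (by omega) (by omega)
  obtain ⟨q', hq', h3, h4⟩ := T.exists_touch hp.2.1 (by omega) hh₁ hh₂
  have hqq : q < q' := by
    by_contra hcon
    exact T.not_touch_two hp.1 hp.2.1 hp.2.2.1 hq h1 (by omega) (by omega)
  refine ⟨q, q', ⟨hq, hq', hqq, fun x hx => ?_⟩, h1, h2, h3, h4⟩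
  by_contra! hcon
  have h5 := T.snd.sepL q x hq.1 hx.1 hcon.1 hq.2.2
  have h6 := T.snd.sepL x q' hx.1 hq'.1 hcon.2 hx.2.2
  obtain ⟨y, hy, h7, h8⟩ := T.symm.exists_touch hx (by omega) (by omega) (by omega)
  rcases hp.2.2.2 y hy with h9 | h9
  · exact T.symm.not_touch_two hq hx hcon.1 hp.1 h2 (by omega) (by omega)
  · exact T.symm.not_touch_two hx hq' hcon.2 hp.2.1 (by omega) h3 (by omega)

theorem TwoChains.run_back (T : TwoChains W S L B₁ lo₁ hi₁ B₂ lo₂ hi₂) {p q : ℕ}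
    (hp : LBlock W L B₁ hi₁ p) (hq : LBlock W L B₂ hi₂ q) (hlo : lo₂ ≤ p)
    (h2 : q < p + L.length) (hhi : q + L.length ≤ hi₁) (j : ℕ)
    (hj : p + j * S.length < q) : ∃ x, x + (j + 1) * S.length = q ∧ B₂ x ∧
      ∀ i < j + 1, OccAt W S (x + i * S.length) := by
  have key : ∀ b, B₂ b → p < b → b ≤ q → ∃ x, x + S.length = b ∧ B₂ x ∧ OccAt W S x := by
    intro b hb hpb hbq
    obtain ⟨x, hx, hxb, h3 | h3⟩ := T.snd.prev T.short hb (by omega)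
    · exact ⟨x, h3.2, hx, h3.1⟩
    · exact (T.symm.not_touch_two h3.1 hq (by omega) hp (by omega) h2 hhi).elim
  induction j with
  | zero =>
    obtain ⟨x, h3, h4, h5⟩ := key q hq.1 (by omega) le_rfl
    refine ⟨x, by omega, h4, fun i hi => ?_⟩
    rw [show i = 0 by omega]
    simpa using h5
  | succ j ih =>
    have hmul : (j + 1) * S.length = j * S.length + S.length := by ring
    have hmul' : (j + 1 + 1) * S.length = j * S.length + S.length + S.length := by ring
    obtain ⟨b, h3, h4, h5⟩ := ih (by omega)
    obtain ⟨x, h6, h7, h8⟩ := key b h4 (by omega) (by omega)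
    refine ⟨x, by omega, h7, fun i hi => ?_⟩
    cases i with
    | zero => simpa using h8
    | succ i =>
      have := h5 i (by omega)
      rwa [← h6, show x + S.length + i * S.length = x + (i + 1) * S.length by ring] at this

theorem TwoChains.run_forward (T : TwoChains W S L B₁ lo₁ hi₁ B₂ lo₂ hi₂) {p q : ℕ}
    (hp : LBlock W L B₁ hi₁ p) (hq : LBlock W L B₂ hi₂ q)
    (h2 : p < q + L.length) (hhi₁ : p + 2 * L.length ≤ hi₁) (hhi₂ : p + L.length ≤ hi₂) (j : ℕ)
    (hj : q + L.length + j * S.length < p + L.length) :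
      ∀ i < j + 1, OccAt W S (q + L.length + i * S.length) := by
  have key : ∀ b, B₂ b → q + L.length ≤ b → b < p + L.length →
      OccAt W S b ∧ B₂ (b + S.length) := by
    intro b hb hqb hbp
    refine T.snd.next_short hb (by omega) fun hL => ?_
    have := List.length_pos_iff.2 T.short.long_ne
    exact T.symm.not_touch_two hq hL (by omega) hp h2 hbp (by omega)
  have main : B₂ (q + L.length + (j + 1) * S.length) ∧
      ∀ i < j + 1, OccAt W S (q + L.length + i * S.length) := by
    induction j with
    | zero =>
      obtain ⟨h3, h4⟩ := key _ (T.snd.next_long T.short hq) le_rfl (by omega)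
      refine ⟨by simpa using h4, fun i hi => ?_⟩
      rw [show i = 0 by omega]
      simpa using h3
    | succ j ih =>
      have hmul : (j + 1) * S.length = j * S.length + S.length := by ring
      obtain ⟨h3, h4⟩ := ih (by omega)
      obtain ⟨h5, h6⟩ := key _ h3 (by omega) (by omega)
      refine ⟨by rwa [Nat.succ_mul (j + 1), ← add_assoc], fun i hi => ?_⟩
      rcases Nat.lt_succ_iff_lt_or_eq.1 hi with hi | rfl
      · exact h4 i hi
      · exact h5
  exact main.2

end Touching

section Crossing

variable {A : Type*} {W : ℕ → A} {S L : List A} {B₁ B₂ : ℕ → Prop} {lo₁ hi₁ lo₂ hi₂ : ℕ}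

theorem TwoChains.long_lt (T : TwoChains W S L B₁ lo₁ hi₁ B₂ lo₂ hi₂) {p p' q : ℕ}
    (hp : Consec W L B₁ hi₁ p p') (hq : LBlock W L B₂ hi₂ q) (h1 : q < p + L.length)
    (hhi : p' + L.length ≤ hi₂) : q + L.length < p' := by
  by_contra! hcon
  rcases hcon.eq_or_lt with h | h
  · exact T.disj p' hp.2.1.1 (h ▸ T.snd.next_long T.short hq)
  · exact T.not_touch_two hp.1 hp.2.1 hp.2.2.1 hq h1 h hhi

theorem TwoChains.not_parallel (T : TwoChains W S L B₁ lo₁ hi₁ B₂ lo₂ hi₂) {p p' q q' : ℕ}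
    (hp : Consec W L B₁ hi₁ p p') (hq : Consec W L B₂ hi₂ q q') (hlo : lo₂ ≤ p)
    (hh₁ : p' + L.length ≤ hi₁) (hh₂ : p' + L.length ≤ hi₂)
    (h1 : p < q) (h2 : q < p + L.length) (h3 : p' < q') (h4 : q' < p' + L.length) : False := by
  have hgap := T.long_lt hp hq.1 h2 hh₂
  have hpos := T.short.short_pos
  obtain ⟨m, hm, hrun⟩ := hp.run T.fst T.short
  obtain ⟨n, hn, hrun'⟩ := hq.run T.snd T.short
  rcases lt_trichotomy m n with hmn | rfl | hmn
  · obtain ⟨k, rfl⟩ := Nat.exists_eq_add_of_lt hmn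
    have hmul : (m + k + 1) * S.length = m * S.length + k * S.length + S.length := by ring
    have hX := hrun' m (by omega)
    have := hp.2.1.2.2.seg_eq hp.1.2.2 (a := q + L.length + m * S.length)
      (b := q + L.length + m * S.length + S.length) (c := q) (d := q + S.length)
      (by omega) (by omega) (by omega) (by omega) (by omega)
    exact T.short.not_occAt (this.symm.trans hX) hq.1.2.2
  · refine T.short.minimal.false_of_shift T.short.short_ne (s := seg W p q)
      (t := seg W q (p + L.length)) (seg_ne_nil h1) (seg_ne_nil h2) m m
      (hp.1.2.2.eq_append h1.le rfl h2.le) ?_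
    have e1 : seg W p q = seg W p' q' := hp.1.2.2.seg_eq hp.2.1.2.2 le_rfl h1.le h2.le
      (by omega) (by omega)
    have e2 : seg W p q ++ seg W q (p + L.length) = L :=
      (hp.1.2.2.eq_append h1.le rfl h2.le).symm
    have e3 := seg_eq_wpow m hrun
    have e4 := seg_eq_wpow m hrun'
    rw [← hm] at e3
    rw [← hn] at e4
    rw [e2, e1, ← e3, seg_append h2.le (hp.long_le T.fst), seg_append (by omega) h3.le,
      ← seg_append (Nat.le_add_right q L.length) (by omega), e3, e4]
    congr 1
    exact hq.1.2.2
  · obtain ⟨k, rfl⟩ := Nat.exists_eq_add_of_lt hmn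
    have hmul : (n + k + 1) * S.length = n * S.length + k * S.length + S.length := by ring
    have hmul' : (k + 1) * S.length = k * S.length + S.length := by ring
    obtain ⟨x, hx, -, hxS⟩ := T.run_back hp.1 hq.1 hlo h2 (by omega) k (by omega)
    have hX := hxS 0 (by omega)
    rw [Nat.zero_mul, Nat.add_zero] at hX
    have := hp.1.2.2.seg_eq hp.2.1.2.2 (a := x) (b := x + S.length) (c := q')
      (d := q' + S.length) (by omega) (by omega) (by omega) (by omega) (by omega)
    exact T.short.not_occAt (this.symm.trans hX) hq.2.1.2.2

theorem TwoChains.not_crossing (T : TwoChains W S L B₁ lo₁ hi₁ B₂ lo₂ hi₂) {p p' q q' : ℕ}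
    (hp : Consec W L B₁ hi₁ p p') (hq : Consec W L B₂ hi₂ q q') (hlo : lo₂ ≤ p)
    (hh₁ : p' + 2 * L.length ≤ hi₁) (hh₂ : p' + L.length ≤ hi₂)
    (h1 : p < q) (h2 : q < p + L.length) (h3 : q' < p') (h4 : p' < q' + L.length) : False := by
  have hpos := T.short.short_pos
  have hpL := T.fst.next_long T.short hp.1
  have hlo₁ := T.fst.lo_le _ hpL
  have hqq := hq.long_le T.snd
  have hshort : ∀ x, B₁ x → p + L.length ≤ x → x < p' → OccAt W S x ∧ B₁ (x + S.length) := by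
    intro x hx hpx hxp
    refine T.fst.next_short hx (by omega) fun hL => ?_
    have := hp.2.2.2 x hL
    omega
  have hq'eq : q' = q + L.length := by
    obtain ⟨n, hn, hrun⟩ := hq.run T.snd T.short
    cases n with
    | zero => simpa using hn
    | succ n =>
      exfalso
      rw [Nat.succ_mul] at hn
      obtain ⟨X, hX⟩ : ∃ X, X = q + L.length + n * S.length := ⟨_, rfl⟩
      have hXS := hrun n (by omega)
      rw [← hX] at hXS
      obtain ⟨c, hc, hcX, hmax⟩ := T.fst.exists_last (x := X) (by omega)
      have hcp := hmax _ hpL (by omega)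
      obtain ⟨hcS, hcB⟩ := hshort c hc hcp (by omega)
      have hne : c + S.length ≠ q' := fun h => T.disj _ hcB (h ▸ hq.2.1.1)
      have hlt : X < c + S.length := by
        by_contra! hcon
        have := hmax _ hcB hcon
        omega
      exact T.short.not_inner hcS (hshort _ hcB (by omega) (by omega)).1 hXS (by omega) hlt
  obtain ⟨c, hc, hcq, hmax⟩ := T.fst.exists_last (x := q') (by omega)
  have hcp := hmax _ hpL (by omega)
  have hcq' : c ≠ q' := fun h => T.disj _ hc (h ▸ hq.2.1.1)
  obtain ⟨hcS, hcB⟩ := hshort c hc hcp (by omega)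
  have hlt : q' < c + S.length := by
    by_contra! hcon
    have := hmax _ hcB hcon
    omega
  have hcp' := T.fst.sepS c p' hc hp.2.1.1 (by omega) hcS
  obtain ⟨a, ha, hrun⟩ := T.fst.run T.short hpL hc hcp fun x hx hpx => by
    have := hp.2.2.2 x hx
    have := List.length_pos_iff.2 T.short.long_ne
    omega
  obtain ⟨b, hb, hrun'⟩ := T.fst.run T.short hcB hp.2.1.1 hcp' fun x hx hpx => by
    have := hp.2.2.2 x hx
    omega
  obtain ⟨x, hx, -, hback⟩ := T.run_back hp.1 hq.1 hlo h2 (by omega) a (by omega)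
  have hfwd := T.run_forward hp.2.1 hq.2.1 h4 hh₁ hh₂ b (by omega)
  rw [Nat.succ_mul] at hx
  have hx0 := hback 0 (by omega)
  rw [Nat.zero_mul, Nat.add_zero] at hx0
  have w1 := seg_eq_wpow a hrun
  have w2 := seg_eq_wpow b hrun'
  have w3 : seg W (x + S.length) q = wpow S a := by
    rw [← seg_eq_wpow (W := W) (S := S) (a := x + S.length) a fun j hj => ?_]
    · congr 1
      omega
    · have := hback (j + 1) (by omega)
      rwa [show x + (j + 1) * S.length = x + S.length + j * S.length by ring] at this
  have w4 := seg_eq_wpow b fun j hj => hfwd j (by omega)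
  rw [← ha] at w1
  rw [← hb] at w2
  refine T.short.minimal.false_of_cross (s := seg W q' (c + S.length)) (f := seg W c q')
    (s' := seg W p (x + S.length)) (f' := seg W (q' + L.length + b * S.length) (p' + L.length))
    (t := seg W q (p + L.length)) (r := seg W p' (q' + L.length)) (seg_ne_nil hlt)
    (seg_ne_nil (by omega)) (seg_ne_nil h2) (seg_ne_nil h4) a b
    (hcS.eq_append hcq rfl hlt.le) ((hfwd b (by omega)).seg_prefix_of_le (by omega) (by omega))
    (hx0.seg_suffix (by omega) rfl (by omega)) (by simp only [length_seg]; omega)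
    (by simp only [length_seg]; omega) ?_ ?_ ?_ ?_
  · rw [← w3, seg_append (by omega) h2.le, seg_append (by omega) (by omega)]
    exact hp.1.2.2.symm
  · rw [← w1, seg_append hcp hcq, seg_append h2.le (by omega), hq'eq]
    exact hq.1.2.2.symm
  · rw [← w2, seg_append hcp' h4.le, seg_append hlt.le (by omega)]
    exact hq.2.1.2.2.symm
  · rw [← w4, seg_append (by omega) (by omega), seg_append h4.le (by omega)]
    exact hp.2.1.2.2.symm

theorem TwoChains.not_consec (T : TwoChains W S L B₁ lo₁ hi₁ B₂ lo₂ hi₂) {p p' : ℕ}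
    (hp : Consec W L B₁ hi₁ p p') (hlo₁ : lo₁ + L.length ≤ p) (hlo₂ : lo₂ ≤ p)
    (hh₁ : p' + 3 * L.length ≤ hi₁) (hh₂ : p' + 3 * L.length ≤ hi₂) : False := by
  obtain ⟨q, q', hq, h1, h2, h3, h4⟩ := T.exists_consec_touch hp hlo₂ hh₁ hh₂
  have hne : q ≠ p := fun h => T.disj p hp.1.1 (h ▸ hq.1.1)
  have hne' : q' ≠ p' := fun h => T.disj p' hp.2.1.1 (h ▸ hq.2.1.1)
  rcases hne.lt_or_gt with h5 | h5 <;> rcases hne'.lt_or_gt with h6 | h6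
  · exact T.symm.not_parallel hq hp (by omega) (by omega) (by omega) h5 h2 h6 h4
  · exact T.symm.not_crossing hq hp (by omega) (by omega) (by omega) h5 h2 h6 h3
  · exact T.not_crossing hp hq hlo₂ (by omega) (by omega) h5 h1 h6 h4
  · exact T.not_parallel hp hq hlo₂ (by omega) (by omega) h5 h1 h6 h3

end Crossing

section Blocks

variable {A : Type*} {W : ℕ → A} {S L : List A}

theorem sigmaMap_append (u v : List A) (a b : List Bool) :
    sigmaMap u v (a ++ b) = sigmaMap u v a ++ sigmaMap u v b := by
  simp [sigmaMap]

theorem sigmaMap_singleton (u v : List A) (c : Bool) :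
    sigmaMap u v [c] = if c then v else u := by
  simp [sigmaMap]

theorem sigmaMap_map_not (u v : List A) (w : List Bool) :
    sigmaMap u v (w.map not) = sigmaMap v u w := by
  simp only [sigmaMap, List.map_map]
  congr 1
  refine List.map_congr_left fun c _ => ?_
  cases c <;> rfl

theorem sigmaMap_take_add_one (u v : List A) {w : List Bool} {k : ℕ} (hk : k < w.length) :
    sigmaMap u v (w.take (k + 1)) = sigmaMap u v (w.take k) ++ if w[k] then v else u := by
  rw [← List.take_append_getElem hk, sigmaMap_append, sigmaMap_singleton]

theorem length_sigmaMap_take_le (u v : List A) (w : List Bool) {k n : ℕ} (h : k ≤ n) :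
    (sigmaMap u v (w.take k)).length ≤ (sigmaMap u v (w.take n)).length := by
  obtain ⟨r, hr⟩ := List.take_prefix_take_left (l := w) h
  rw [← hr, sigmaMap_append, List.length_append]
  omega

theorem OccAt.left {P Q : List A} {x : ℕ} (h : OccAt W (P ++ Q) x) : OccAt W P x := by
  have h1 : seg W x (x + (P ++ Q).length) = P ++ Q := h
  rw [List.length_append, ← seg_append (y := x + P.length) (by omega) (by omega)] at h1
  exact (List.append_inj h1 (by rw [length_seg]; omega)).1

theorem OccAt.right {P Q : List A} {x : ℕ} (h : OccAt W (P ++ Q) x) :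
    OccAt W Q (x + P.length) := by
  have h1 : seg W x (x + (P ++ Q).length) = P ++ Q := h
  rw [List.length_append, ← seg_append (y := x + P.length) (by omega) (by omega)] at h1
  have h2 := (List.append_inj h1 (by rw [length_seg]; omega)).2
  rwa [← add_assoc] at h2

theorem occAt_getD (l : List A) (d : A) : OccAt (fun i => l.getD i d) l 0 := by
  refine List.ext_getElem (by rw [length_seg]; omega) fun i h1 h2 => ?_
  simp [seg, factorAt, h2]

/-- The boundaries of the blocks of `σ(w)`, where `σ(w)` starts at the position `off`. -/
def Boundary (S L : List A) (w : List Bool) (off x : ℕ) : Prop :=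
  ∃ k ≤ w.length, x = off + (sigmaMap S L (w.take k)).length

theorem occAt_block {w : List Bool} {off k : ℕ} (h : OccAt W (sigmaMap S L w) off)
    (hk : k < w.length) :
    OccAt W (if w[k] then L else S) (off + (sigmaMap S L (w.take k)).length) := by
  rw [← List.take_append_drop (k + 1) w, sigmaMap_append, sigmaMap_take_add_one S L hk] at h
  exact h.left.right

theorem chain_boundary (hSL : ShortLong S L) {w : List Bool} {off : ℕ}
    (h : OccAt W (sigmaMap S L w) off) :
    Chain W S L (Boundary S L w off) off (off + (sigmaMap S L w).length) := by
  have hsep : ∀ x y, Boundary S L w off x → Boundary S L w off y → x < y →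
      (OccAt W S x → x + S.length ≤ y) ∧ (OccAt W L x → x + L.length ≤ y) := by
    rintro x y ⟨k, hk, rfl⟩ ⟨n, hn, rfl⟩ hxy
    have hkn : k < n := by
      by_contra! hcon
      have := length_sigmaMap_take_le S L w hcon
      omega
    have hkw : k < w.length := by omega
    have hle := length_sigmaMap_take_le S L w (show k + 1 ≤ n from hkn)
    rw [sigmaMap_take_add_one S L hkw, List.length_append] at hle
    have hb := occAt_block h hkw
    cases hwk : w[k] <;> simp only [hwk, if_true, Bool.false_eq_true, if_false] at hb hle
    · exact ⟨fun _ => by omega, fun hL => (hSL.not_occAt hb hL).elim⟩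
    · exact ⟨fun hS => (hSL.not_occAt hS hb).elim, fun _ => by omega⟩
  refine ⟨⟨0, by omega, by simp [sigmaMap]⟩, ?_, ?_, ?_,
    fun x y hx hy hxy => (hsep x y hx hy hxy).1, fun x y hx hy hxy => (hsep x y hx hy hxy).2⟩
  · rintro x ⟨k, -, rfl⟩
    omega
  · rintro x ⟨k, hk, rfl⟩
    have := length_sigmaMap_take_le S L w hk
    rw [List.take_length] at this
    omega
  · rintro x ⟨k, hk, rfl⟩ hlt
    have hkw : k < w.length := by
      rcases hk.eq_or_lt with rfl | hkw
      · rw [List.take_length] at hlt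
        omega
      · exact hkw
    have hb := occAt_block h hkw
    have hB : Boundary S L w off (off + (sigmaMap S L (w.take (k + 1))).length) :=
      ⟨k + 1, hkw, rfl⟩
    rw [sigmaMap_take_add_one S L hkw, List.length_append, ← add_assoc] at hB
    cases hwk : w[k] <;> simp only [hwk, if_true, Bool.false_eq_true, if_false] at hb hB
    · exact Or.inl ⟨hb, hB⟩
    · exact Or.inr ⟨hb, hB⟩

theorem lBlock_of_getElem? (hSL : ShortLong S L) {w : List Bool} {off k : ℕ}
    (h : OccAt W (sigmaMap S L w) off) (hk : w[k]? = some true) :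
    LBlock W L (Boundary S L w off) (off + (sigmaMap S L w).length)
      (off + (sigmaMap S L (w.take k)).length) := by
  obtain ⟨hkw, hwk⟩ := List.getElem?_eq_some_iff.1 hk
  have hb := occAt_block h hkw
  have h1 := sigmaMap_take_add_one S L hkw
  simp only [hwk, if_true] at hb h1
  have hle := length_sigmaMap_take_le S L w (show k + 1 ≤ w.length from hkw)
  rw [h1, List.length_append, List.take_length] at hle
  have := List.length_pos_iff.2 hSL.long_ne
  exact ⟨⟨k, hkw.le, rfl⟩, by omega, hb⟩

theorem long_le_of_getElem? {w : List Bool} {k n : ℕ} (hk : w[k]? = some true) (hkn : k < n) :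
    (sigmaMap S L (w.take k)).length + L.length ≤ (sigmaMap S L (w.take n)).length := by
  obtain ⟨hkw, hwk⟩ := List.getElem?_eq_some_iff.1 hk
  have h1 := sigmaMap_take_add_one S L hkw
  simp only [hwk, if_true] at h1
  have hle := length_sigmaMap_take_le S L w (show k + 1 ≤ n from hkn)
  rwa [h1, List.length_append] at hle

theorem ShortLong.not_factor (hSL : ShortLong S L) {w : List Bool} {z : List A}
    (hz : z.length = L.length) (hzS : ¬ S <+: z) (hzL : ¬ L <+: z) {i₁ i₂ i₃ i₄ i₅ : ℕ}
    (h12 : i₁ < i₂) (h23 : i₂ < i₃) (h34 : i₃ < i₄) (h45 : i₄ < i₅)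
    (h1 : w[i₁]? = some true) (h2 : w[i₂]? = some true) (h3 : w[i₃]? = some true)
    (h4 : w[i₄]? = some true) (h5 : w[i₅]? = some true) (w' : List Bool) :
    ¬ (sigmaMap S L w ++ z) <:+: sigmaMap S L w' := by
  rintro ⟨a, b, hab⟩
  have hpos := hSL.short_pos
  have hle := hSL.le
  obtain ⟨W, hW⟩ : ∃ W : ℕ → A, OccAt W (sigmaMap S L w') 0 :=
    ⟨_, occAt_getD _ (S.head hSL.short_ne)⟩
  have C₂ := chain_boundary hSL hW
  have hlen := congrArg List.length hab
  simp only [List.length_append] at hlen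
  rw [zero_add] at C₂
  rw [← hab] at hW
  have hwz := hW.left.right
  rw [zero_add] at hwz
  have C₁ := chain_boundary hSL hwz.left
  have hzW := hwz.right
  have hdisj : ∀ x, Boundary S L w a.length x → Boundary S L w' 0 x → False := by
    intro x hx hx'
    obtain ⟨n, hn⟩ : ∃ n, a.length + (sigmaMap S L w).length - x = n := ⟨_, rfl⟩
    induction n using Nat.strong_induction_on generalizing x with
    | _ n ih =>
      have hxle := C₁.le_hi x hx
      rcases hxle.eq_or_lt with rfl | hlt
      · rcases C₂.next _ hx' (by omega) with ⟨hb, -⟩ | ⟨hb, -⟩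
        · exact hzS (hb ▸ hzW.seg_prefix_of_le (by omega) (by omega))
        · exact hzL (hb ▸ hzW.seg_prefix_of_le (by omega) (by omega))
      · rcases C₁.next x hx hlt with ⟨hb, hb1⟩ | ⟨hb, hb1⟩ <;>
          rcases C₂.next x hx' (by omega) with ⟨hb', hb2⟩ | ⟨hb', hb2⟩
        · exact ih _ (by omega) _ hb1 hb2 rfl
        · exact hSL.not_occAt hb hb'
        · exact hSL.not_occAt hb' hb
        · exact ih _ (by omega) _ hb1 hb2 rfl
  have T : TwoChains W S L (Boundary S L w a.length) a.length
      (a.length + (sigmaMap S L w).length) (Boundary S L w' 0) 0 (sigmaMap S L w').length :=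
    ⟨hSL, C₁, C₂, hdisj⟩
  have hl1 := long_le_of_getElem? (S := S) (L := L) h1 h12
  have hl2 := long_le_of_getElem? (S := S) (L := L) h2 h23
  have hl3 := long_le_of_getElem? (S := S) (L := L) h3 h34
  have hl4 := long_le_of_getElem? (S := S) (L := L) h4 h45
  have hl5 := long_le_of_getElem? (S := S) (L := L) h5 (List.getElem?_eq_some_iff.1 h5).1
  rw [List.take_length] at hl5
  obtain ⟨q, hq, hqle⟩ := exists_consec (lBlock_of_getElem? hSL hwz.left h2)
    (lBlock_of_getElem? hSL hwz.left h3) (by omega)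
  exact T.not_consec hq (by omega) (by omega) (by omega) (by omega)

theorem exists_five_of_countXY {w : List Bool} (hw : 5 ≤ countXY w) :
    ∃ i₁ i₂ i₃ i₄ i₅ : ℕ, i₁ < i₂ ∧ i₂ < i₃ ∧ i₃ < i₄ ∧ i₄ < i₅ ∧
      ∀ i ∈ [i₁, i₂, i₃, i₄, i₅], w[i]? = some false ∧ w[i + 1]? = some true := by
  have hmem : ∀ i ∈ (List.range w.length).filter fun i => decide ([false, true] <+: w.drop i),
      w[i]? = some false ∧ w[i + 1]? = some true := by
    intro i hi
    simp only [List.mem_filter, decide_eq_true_eq] at hi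
    obtain ⟨t, ht⟩ := hi.2
    have e0 := congrArg (fun l => l[0]?) ht
    have e1 := congrArg (fun l => l[1]?) ht
    simp only [List.getElem?_drop] at e0 e1
    exact ⟨by simpa using e0.symm, by simpa using e1.symm⟩
  have hp := (List.pairwise_lt_range (n := w.length)).filter
    fun i => decide ([false, true] <+: w.drop i)
  unfold countXY at hw
  generalize ((List.range w.length).filter fun i => decide ([false, true] <+: w.drop i)) = l
    at hmem hp hw
  match l, hw with
  | i₁ :: i₂ :: i₃ :: i₄ :: i₅ :: l, _ =>
    simp only [List.pairwise_cons, List.mem_cons] at hp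
    refine ⟨i₁, i₂, i₃, i₄, i₅, hp.1 _ (by simp), hp.2.1 _ (by simp), hp.2.2.1 _ (by simp),
      hp.2.2.2.1 _ (by simp), fun i hi => hmem i ?_⟩
    simp only [List.mem_cons, List.not_mem_nil, or_false] at hi ⊢
    tauto

end Blocks

/-- With `u`, `v` a minimal pair and `σ : {x,y}^* → Σ^*` the morphism `x ↦ u`, `y ↦ v`
(letters `x`, `y` encoded as `false`, `true`), if `w` contains at least five occurrences
of the factor `xy` and `z` is a word of length `max(|u|,|v|)` having neither `u` nor `v`
as a prefix, then `σ(w)·z` is not a factor of any word in `{u,v}^*`. -/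
theorem sigma_w_z_not_factor {A : Type*} [Fintype A] (u v : List A)
    (hu : u ≠ []) (hv : v ≠ []) (hmin : MinimalPair u v)
    (w : List Bool) (hw : 5 ≤ countXY w)
    (z : List A) (hz : z.length = max u.length v.length)
    (hzu : ¬ u <+: z) (hzv : ¬ v <+: z) :
    ¬ ∃ w' : List Bool, (sigmaMap u v w ++ z) <:+: sigmaMap u v w' := by
  rintro ⟨w', hw'⟩
  obtain ⟨i₁, i₂, i₃, i₄, i₅, h12, h23, h34, h45, h⟩ := exists_five_of_countXY hw
  simp only [List.forall_mem_cons] at h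
  obtain ⟨⟨a1, b1⟩, ⟨a2, b2⟩, ⟨a3, b3⟩, ⟨a4, b4⟩, ⟨a5, b5⟩, -⟩ := h
  rcases le_total u.length v.length with hle | hle
  · exact ShortLong.not_factor ⟨hmin, hu, hv, hle⟩ (by omega) hzu hzv (by omega) (by omega)
      (by omega) (by omega) b1 b2 b3 b4 b5 w' hw'
  · rw [← sigmaMap_map_not v u w, ← sigmaMap_map_not v u w'] at hw'
    exact ShortLong.not_factor ⟨hmin.symm, hv, hu, hle⟩ (by omega) hzv hzu h12 h23 h34 h45
      (by simp [a1]) (by simp [a2]) (by simp [a3]) (by simp [a4]) (by simp [a5]) _ hw'
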